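/- Let n ≥ 1 and m < 0, and let v₀ : ℝⁿ → ℝ be continuous and everywhere positive with v₀(x) ≤ C₀ (1+|x|)^{θ} for all x ∈ ℝⁿ, where C₀ > 0 and θ > 0. Then every global positive classical solution v of the Cauchy problem (F) with initial data v₀ has the property that there exists C > 0 with inf_{x∈ℝⁿ} v(x,t) ≤ C · t^{θ/((1−m)θ+2)} for all t > 1. -/

import Mathlib

open MeasureTheory
open scoped ENNReal
noncomputable section

abbrev Euc (n : ℕ) := EuclideanSpace ℝ (Fin n)

/-- The divergence (in the spatial variables) of a vector field `F : ℝⁿ → ℝⁿ`. -/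
def divg (n : ℕ) (F : Euc n → Euc n) (x : Euc n) : ℝ :=
  ∑ i : Fin n, fderiv ℝ F x (EuclideanSpace.single i 1) i

/-- `IsSolF n m v₀ v T` means: `v` is a classical solution of the Cauchy problem (F):
`∂ₜ v = ∇·(v^{m-1} ∇v)` on `ℝⁿ × (0,T)`, `v(·,0) = v₀`, belonging to
`C⁰(ℝⁿ × [0,T)) ∩ C^{2,1}(ℝⁿ × (0,T))`.  Here `T ∈ (0,∞]` is encoded as `T : ℝ≥0∞`. -/
structure IsSolF (n : ℕ) (m : ℝ) (v₀ : Euc n → ℝ) (v : Euc n → ℝ → ℝ) (T : ℝ≥0∞) : Prop where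
  cont : ContinuousOn (fun q : Euc n × ℝ => v q.1 q.2) {q | 0 ≤ q.2 ∧ ENNReal.ofReal q.2 < T}
  init : ∀ x, v x 0 = v₀ x
  reg_space : ∀ t : ℝ, 0 < t → ENNReal.ofReal t < T → ContDiff ℝ 2 fun x => v x t
  reg_time : ∀ x, ∀ t : ℝ, 0 < t → ENNReal.ofReal t < T → DifferentiableAt ℝ (v x) t
  pde : ∀ x, ∀ t : ℝ, 0 < t → ENNReal.ofReal t < T →
    deriv (v x) t =
      divg n (fun y => v y t ^ (m - 1) • gradient (fun z => v z t) y) x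

/-- `v` is positive on `ℝⁿ × [0,T)`. -/
def PosOn (n : ℕ) (v : Euc n → ℝ → ℝ) (T : ℝ≥0∞) : Prop :=
  ∀ x : Euc n, ∀ t : ℝ, 0 ≤ t → ENNReal.ofReal t < T → 0 < v x t

/-- `v` is the maximal global positive classical solution of (F) with initial data `v₀`:
it is a global positive classical solution and lies above every positive classical solution
with the same initial data on its interval of existence `[0,T)`, `T ∈ (0,∞]`. -/
def IsMaxSolF (n : ℕ) (m : ℝ) (v₀ : Euc n → ℝ) (v : Euc n → ℝ → ℝ) : Prop :=
  IsSolF n m v₀ v ⊤ ∧ PosOn n v ⊤ ∧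
    ∀ T : ℝ≥0∞, 0 < T → ∀ w : Euc n → ℝ → ℝ, IsSolF n m v₀ w T → PosOn n w T →
      ∀ x : Euc n, ∀ t : ℝ, 0 ≤ t → ENNReal.ofReal t < T → w x t ≤ v x t

open Set Filter Topology

theorem nonneg_of_isLocalMin_of_hasDerivAt {φ φ' : ℝ → ℝ} {a c : ℝ} (hmin : IsLocalMin φ a)
    (h1 : ∀ s, HasDerivAt φ (φ' s) s) (h2 : HasDerivAt φ' c a) : 0 ≤ c := by
  by_contra! hc
  have hd : deriv φ = φ' := funext fun s => (h1 s).deriv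
  have hmax : IsLocalMax φ a := by
    apply isLocalMax_of_deriv_deriv_neg
    · rw [hd, h2.deriv]; exact hc
    · exact hmin.deriv_eq_zero
    · exact (h1 a).continuousAt
  have hconst : φ =ᶠ[𝓝 a] fun _ => φ a := by
    filter_upwards [hmin, hmax] with s hs hs' using le_antisymm hs' hs
  have h3 := hconst.deriv
  rw [hd] at h3
  have h4 := h3.deriv_eq
  rw [h2.deriv] at h4
  simp at h4
  exact hc.ne h4

theorem gradient_apply_eq_fderiv {n : ℕ} {g : Euc n → ℝ} (y : Euc n) (i : Fin n) :
    gradient g y i = fderiv ℝ g y (EuclideanSpace.single i 1) := by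
  have h : inner ℝ (gradient g y) (EuclideanSpace.single i (1 : ℝ))
      = fderiv ℝ g y (EuclideanSpace.single i 1) := by
    rw [gradient, InnerProductSpace.toDual_symm_apply]
  rw [← h, EuclideanSpace.inner_single_right]
  simp

/-- Touching `g ^ m` from below by a paraboloid bounds `∇·(g^{m-1}∇g)` from above. -/
theorem divg_le_of_paraboloid_touches {n : ℕ} {m B R : ℝ} (hm : m < 0) {g : Euc n → ℝ}
    (hg : ContDiff ℝ 2 g) (hpos : ∀ x, 0 < g x) {x₀ : Euc n}
    (hle : ∀ᶠ x in 𝓝 x₀, B * (1 - ‖x‖ ^ 2 / R ^ 2) ≤ g x ^ m)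
    (heq : B * (1 - ‖x₀‖ ^ 2 / R ^ 2) = g x₀ ^ m) :
    divg n (fun y => g y ^ (m - 1) • gradient g y) x₀ ≤ n * (-2 * B / (m * R ^ 2)) := by
  set F : Euc n → Euc n := fun y => g y ^ (m - 1) • gradient g y with hF
  have hgd : Differentiable ℝ g := hg.differentiable (by norm_num)
  have hgrad : Differentiable ℝ (gradient g) := by
    have h : Differentiable ℝ (fderiv ℝ g) :=
      (hg.fderiv_right (m := 1) (by norm_num)).differentiable (by norm_num)
    exact (InnerProductSpace.toDual ℝ (Euc n)).symm.differentiable.comp h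
  have hFd : Differentiable ℝ F := by
    intro y
    exact ((hgd y).rpow_const (Or.inl (hpos y).ne')).smul (hgrad y)
  have key : ∀ i : Fin n, fderiv ℝ F x₀ (EuclideanSpace.single i 1) i ≤ -2 * B / (m * R ^ 2) := by
    intro i
    set e : Euc n := EuclideanSpace.single i 1 with he
    have hline : ∀ s : ℝ, HasDerivAt (fun s : ℝ => x₀ + s • e) e s := by
      intro s
      simpa using ((hasDerivAt_id s).smul_const e).const_add x₀
    have hnorm : ∀ s : ℝ, ‖x₀ + s • e‖ ^ 2 = ‖x₀‖ ^ 2 + 2 * s * x₀ i + s ^ 2 := by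
      intro s
      rw [norm_add_sq_real, inner_smul_right, he, EuclideanSpace.inner_single_right, norm_smul]
      simp
      ring
    let φ : ℝ → ℝ := fun s =>
      (B * (1 - (‖x₀‖ ^ 2 + 2 * s * x₀ i + s ^ 2) / R ^ 2) - g (x₀ + s • e) ^ m) / m
    let φ' : ℝ → ℝ := fun s => B * (-(2 * x₀ i + 2 * s) / R ^ 2) / m - F (x₀ + s • e) i
    have h1 : ∀ s, HasDerivAt φ (φ' s) s := by
      intro s
      have hgs : HasDerivAt (fun s : ℝ => g (x₀ + s • e)) (fderiv ℝ g (x₀ + s • e) e) s :=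
        (hgd _).hasFDerivAt.comp_hasDerivAt s (hline s)
      have hu := hgs.rpow_const (p := m) (Or.inl (hpos (x₀ + s • e)).ne')
      have hq : HasDerivAt (fun s : ℝ => B * (1 - (‖x₀‖ ^ 2 + 2 * s * x₀ i + s ^ 2) / R ^ 2))
          (B * (-(2 * x₀ i + 2 * s) / R ^ 2)) s := by
        have h := ((((((hasDerivAt_id s).const_mul 2).mul_const (x₀ i)).const_add (‖x₀‖ ^ 2)).add
          ((hasDerivAt_id s).pow 2)).div_const (R ^ 2)).const_sub 1 |>.const_mul B
        refine h.congr_deriv ?_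
        simp
        ring
      refine ((hq.sub hu).div_const m).congr_deriv ?_
      simp only [φ', hF, PiLp.smul_apply, smul_eq_mul, gradient_apply_eq_fderiv]
      have := hm.ne
      rw [← he]
      field_simp
    have h2 : HasDerivAt φ' (B * (-2 / R ^ 2) / m - fderiv ℝ F x₀ e i) 0 := by
      have hFs : HasDerivAt (fun s : ℝ => F (x₀ + s • e)) (fderiv ℝ F x₀ e) 0 := by
        have h := (hFd (x₀ + (0 : ℝ) • e)).hasFDerivAt.comp_hasDerivAt 0 (hline 0)
        rwa [zero_smul, add_zero] at h
      have hFi : HasDerivAt (fun s : ℝ => F (x₀ + s • e) i) (fderiv ℝ F x₀ e i) 0 :=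
        (EuclideanSpace.proj (𝕜 := ℝ) i).hasFDerivAt.comp_hasDerivAt 0 hFs
      refine HasDerivAt.sub ?_ hFi
      have h := (((((hasDerivAt_id (0 : ℝ)).const_mul 2).const_add (2 * x₀ i)).neg.div_const
        (R ^ 2)).const_mul B).div_const m
      exact h.congr_deriv (by simp)
    have hmin : IsLocalMin φ 0 := by
      have hcts : Tendsto (fun s : ℝ => x₀ + s • e) (𝓝 0) (𝓝 x₀) := by
        simpa using (hline 0).continuousAt.tendsto
      filter_upwards [hcts.eventually hle] with s hs
      have h0 : φ 0 = 0 := by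
        simp only [φ]
        simp [heq]
      rw [h0]
      rw [hnorm] at hs
      exact div_nonneg_of_nonpos (by linarith) hm.le
    have h3 := nonneg_of_isLocalMin_of_hasDerivAt hmin h1 h2
    have h4 : B * (-2 / R ^ 2) / m = -2 * B / (m * R ^ 2) := by
      rw [mul_div_assoc', div_div, mul_comm (R ^ 2) m, mul_comm B]
    linarith
  calc divg n F x₀ ≤ ∑ _i : Fin n, -2 * B / (m * R ^ 2) := Finset.sum_le_sum fun i _ => key i
    _ = n * (-2 * B / (m * R ^ 2)) := by simp

theorem deriv_nonpos_of_nonneg_left {f : ℝ → ℝ} {f' t : ℝ} (ht : 0 < t)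
    (hf : HasDerivAt f f' t) (h0 : f t = 0) (hpos : ∀ s, 0 ≤ s → s < t → 0 ≤ f s) : f' ≤ 0 := by
  have hs := (hasDerivWithinAt_iff_tendsto_slope' (s := Iio t) (by simp)).1 hf.hasDerivWithinAt
  refine le_of_tendsto hs ?_
  have : ∀ᶠ s in 𝓝[<] t, 0 < s := nhdsWithin_le_nhds (lt_mem_nhds ht)
  filter_upwards [this, self_mem_nhdsWithin] with s hs hst
  rw [slope_def_field, h0]
  exact div_nonpos_of_nonneg_of_nonpos (by linarith [hpos s hs.le hst]) (by
    have : s < t := hst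
    linarith)

/-- Comparison with the barrier `(A (1 - t/2T) (1 - |x|²/R²))^{1/m}`, infinite on `|x| = R`. -/
theorem barrier_le_rpow {n : ℕ} {m : ℝ} (hm : m < 0) {v₀ : Euc n → ℝ} {v : Euc n → ℝ → ℝ}
    (hv : IsSolF n m v₀ v ⊤) (hvpos : PosOn n v ⊤) {A R T : ℝ} (hA : 0 < A) (hR : 0 < R)
    (hT : 0 < T) (hinit : ∀ x, ‖x‖ ≤ R → A < v₀ x ^ m)
    (hsmall : 4 * n * T * A ^ (1 - 1 / m) < R ^ 2) : A / 2 ≤ v 0 T ^ m := by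
  have hvp : ∀ x t, 0 ≤ t → 0 < v x t := fun x t ht => hvpos x t ht ENNReal.ofReal_lt_top
  by_contra! hlt
  let z : Euc n × ℝ → ℝ := fun q => A * (1 - q.2 / (2 * T)) * (1 - ‖q.1‖ ^ 2 / R ^ 2)
  let u : Euc n × ℝ → ℝ := fun q => v q.1 q.2 ^ m
  let K : Set (Euc n × ℝ) := Metric.closedBall 0 R ×ˢ Icc 0 T
  have hK : IsCompact K := (isCompact_closedBall _ _).prod isCompact_Icc
  have hzc : Continuous z := by fun_prop
  have huc : ContinuousOn u K := by
    have hc : ContinuousOn (fun q : Euc n × ℝ => v q.1 q.2) K :=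
      hv.cont.mono fun q hq => ⟨hq.2.1, ENNReal.ofReal_lt_top⟩
    exact hc.rpow_const fun q hq => Or.inl (hvp _ _ hq.2.1).ne'
  have hSc : IsCompact (K ∩ {q | u q ≤ z q}) := by
    have h : IsClosed (K ∩ (fun q => u q - z q) ⁻¹' Iic 0) :=
      (huc.sub hzc.continuousOn).preimage_isClosed_of_isClosed hK.isClosed isClosed_Iic
    have h' : K ∩ {q | u q ≤ z q} = K ∩ (fun q => u q - z q) ⁻¹' Iic 0 := by
      ext q; simp
    rw [h']
    exact hK.of_isClosed_subset h inter_subset_left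
  have hne : (K ∩ {q | u q ≤ z q}).Nonempty := by
    refine ⟨(0, T), ⟨by simp [hR.le], by simp [hT.le]⟩, ?_⟩
    have : z (0, T) = A / 2 := by
      simp only [z]; field_simp; simp; norm_num
    simp only [mem_ofPred_eq, this]
    exact hlt.le
  obtain ⟨⟨x₀, t₀⟩, ⟨⟨hx₀, ht₀⟩, hle₀⟩, hfirst⟩ :=
    hSc.exists_isMinOn hne continuous_snd.continuousOn
  simp only [mem_ofPred_eq] at hle₀
  have hx₀R : ‖x₀‖ ≤ R := by simpa using hx₀
  have ht₀T : t₀ ≤ T := ht₀.2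
  have ht₀0 : 0 ≤ t₀ := ht₀.1
  have hbefore : ∀ x t, ‖x‖ ≤ R → 0 ≤ t → t < t₀ → z (x, t) < u (x, t) := by
    intro x t hx ht htt
    by_contra! h
    have : t₀ ≤ t := hfirst (a := (x, t))
      ⟨⟨by simpa using hx, ht, htt.le.trans ht₀T⟩, h⟩
    linarith
  have hu₀ : 0 < u (x₀, t₀) := Real.rpow_pos_of_pos (hvp _ _ ht₀0) _
  have hfac : 0 < 1 - t₀ / (2 * T) := by
    rw [sub_pos, div_lt_one (by positivity)]; linarith
  set q := 1 - ‖x₀‖ ^ 2 / R ^ 2 with hq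
  have hq1 : q ≤ 1 := by
    have : 0 ≤ ‖x₀‖ ^ 2 / R ^ 2 := by positivity
    linarith
  have hqpos : 0 < q := by
    have h : 0 < A * (1 - t₀ / (2 * T)) * q := hu₀.trans_le hle₀
    exact (pos_iff_pos_of_mul_pos h).1 (by positivity)
  have hxlt : ‖x₀‖ < R := by
    have : ‖x₀‖ ^ 2 / R ^ 2 < 1 := by linarith
    rw [div_lt_one (by positivity)] at this
    exact lt_of_pow_lt_pow_left₀ 2 hR.le this
  have ht₀pos : 0 < t₀ := by
    rcases ht₀0.eq_or_lt with h | h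
    · exfalso
      have h1 := hinit x₀ hx₀R
      rw [← hv.init, h] at h1
      have h2 : z (x₀, t₀) ≤ A := by
        simp only [z, ← h]
        simp only [zero_div, sub_zero, mul_one]
        nlinarith
      exact absurd (h1.trans_le (hle₀.trans h2)) (lt_irrefl _)
    · exact h
  have hat : ∀ x, ‖x‖ ≤ R → z (x, t₀) ≤ u (x, t₀) := by
    intro x hx
    have hmem : (x, t₀) ∈ K := ⟨by simpa using hx, ht₀⟩
    have hvc : ContinuousAt (v x) t₀ :=
      (hv.reg_time x t₀ ht₀pos ENNReal.ofReal_lt_top).continuousAt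
    have huc' : ContinuousAt (fun t => u (x, t)) t₀ :=
      hvc.rpow_const (Or.inl (hvp _ _ ht₀0).ne')
    have hzc' : ContinuousAt (fun t => z (x, t)) t₀ := by fun_prop
    refine le_of_tendsto_of_tendsto (hzc'.tendsto.mono_left nhdsWithin_le_nhds)
      (huc'.tendsto.mono_left (nhdsWithin_le_nhds (s := Iio t₀))) ?_
    have : ∀ᶠ s in 𝓝[<] t₀, 0 < s := nhdsWithin_le_nhds (lt_mem_nhds ht₀pos)
    filter_upwards [this, self_mem_nhdsWithin] with s hs hst
    exact (hbefore x s hx hs.le hst).le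
  have heq : z (x₀, t₀) = u (x₀, t₀) := le_antisymm (hat x₀ hx₀R) hle₀
  have hdiv := divg_le_of_paraboloid_touches (n := n) (R := R) (B := A * (1 - t₀ / (2 * T))) hm
    (hv.reg_space t₀ ht₀pos ENNReal.ofReal_lt_top) (fun x => hvp x t₀ ht₀0) (x₀ := x₀)
    (by
      have : ∀ᶠ x : Euc n in 𝓝 x₀, ‖x‖ < R := continuous_norm.continuousAt.eventually_lt_const hxlt
      filter_upwards [this] with x hx using hat x hx.le) heq
  rw [← hv.pde x₀ t₀ ht₀pos ENNReal.ofReal_lt_top] at hdiv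
  have hvt := (hv.reg_time x₀ t₀ ht₀pos ENNReal.ofReal_lt_top).hasDerivAt
  have hut := hvt.rpow_const (p := m) (Or.inl (hvp x₀ t₀ ht₀0).ne')
  have hzt : HasDerivAt (fun t => z (x₀, t)) (A * (-(1 / (2 * T))) * q) t₀ :=
    ((((hasDerivAt_id t₀).div_const (2 * T)).const_sub 1).const_mul A).mul_const q
  have htime := deriv_nonpos_of_nonneg_left ht₀pos (hut.sub hzt) (by
      have h : v x₀ t₀ ^ m = z (x₀, t₀) := heq.symm
      simp [h])
    (fun s hs hst => by
      have h := hbefore x₀ s hx₀R hs hst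
      simp only [u] at h
      simp only [Pi.sub_apply]
      linarith)
  have hVpos := hvp x₀ t₀ ht₀0
  set V := v x₀ t₀ with hV
  set W := deriv (v x₀) t₀ with hW
  have hzA : z (x₀, t₀) ≤ A * q := by
    have : 1 - t₀ / (2 * T) ≤ 1 := by
      have : 0 ≤ t₀ / (2 * T) := by positivity
      linarith
    simp only [z]
    rw [← hq]
    have h : A * (1 - t₀ / (2 * T)) ≤ A := by nlinarith
    exact mul_le_mul_of_nonneg_right h hqpos.le
  have hVm : V ^ m ≤ A * q := by
    have h : V ^ m = z (x₀, t₀) := heq.symm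
    rw [h]; exact hzA
  have hVm0 : 0 < V ^ m := Real.rpow_pos_of_pos hVpos _
  have hVpow : V ^ (m - 1) ≤ q * A ^ (1 - 1 / m) := by
    have hexp : 0 ≤ -1 / m := div_nonneg_of_nonpos (by norm_num) hm.le
    have h1 : V ^ (m - 1) = V ^ m * (V ^ m) ^ (-1 / m) := by
      rw [← Real.rpow_mul hVpos.le, ← Real.rpow_add hVpos]
      congr 1
      have := hm.ne
      field_simp
      ring
    have h2 : A ^ (1 - 1 / m) = A * A ^ (-1 / m) := by
      rw [show 1 - 1 / m = 1 + -1 / m by ring, Real.rpow_add hA, Real.rpow_one]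
    have h3 : (V ^ m) ^ (-1 / m) ≤ A ^ (-1 / m) :=
      Real.rpow_le_rpow hVm0.le (hVm.trans (by nlinarith)) hexp
    rw [h1, h2]
    calc V ^ m * (V ^ m) ^ (-1 / m) ≤ (A * q) * A ^ (-1 / m) :=
          mul_le_mul hVm h3 (by positivity) (by positivity)
      _ = q * (A * A ^ (-1 / m)) := by ring
  have hP : 0 < V ^ (m - 1) := Real.rpow_pos_of_pos hVpos _
  have hmW : -(2 * n * A / R ^ 2) ≤ m * W := by
    have h1 : m * (n * (-2 * (A * (1 - t₀ / (2 * T))) / (m * R ^ 2))) ≤ m * W :=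
      mul_le_mul_of_nonpos_left hdiv hm.le
    have h2 : m * (n * (-2 * (A * (1 - t₀ / (2 * T))) / (m * R ^ 2)))
        = -(2 * n * A / R ^ 2) * (1 - t₀ / (2 * T)) := by
      have := hm.ne
      field_simp
    rw [h2] at h1
    refine le_trans ?_ h1
    have h3 : 0 ≤ 2 * n * A / R ^ 2 := by positivity
    have h4 : 0 ≤ t₀ / (2 * T) := by positivity
    nlinarith
  have hc : 0 ≤ 2 * n * A / R ^ 2 := by positivity
  have hfin : A * (1 / (2 * T)) * q ≤ 2 * n * A / R ^ 2 * (q * A ^ (1 - 1 / m)) := by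
    have h1 : -(2 * n * A / R ^ 2) * V ^ (m - 1) ≤ m * W * V ^ (m - 1) :=
      mul_le_mul_of_nonneg_right hmW hP.le
    have h2 := mul_le_mul_of_nonneg_left hVpow hc
    nlinarith
  have hfin' : A * q * R ^ 2 ≤ A * q * (4 * n * T * A ^ (1 - 1 / m)) := by
    have h := mul_le_mul_of_nonneg_left hfin (by positivity : 0 ≤ 2 * T * R ^ 2)
    have h1 : 2 * T * R ^ 2 * (A * (1 / (2 * T)) * q) = A * q * R ^ 2 := by field_simp
    have h2 : 2 * T * R ^ 2 * (2 * n * A / R ^ 2 * (q * A ^ (1 - 1 / m)))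
        = A * q * (4 * n * T * A ^ (1 - 1 / m)) := by field_simp; ring
    rwa [h1, h2] at h
  exact absurd (le_of_mul_le_mul_left hfin' (by positivity)) (not_le.2 hsmall)

/-- Theorem: if `v₀(x) ≤ C₀ (1+|x|)^θ` then every global positive classical solution of (F)
satisfies `inf_x v(x,t) ≤ C t^{θ/((1-m)θ+2)}` for all `t > 1`. -/
theorem stmt11 (n : ℕ) (hn : 1 ≤ n) (m θ C₀ : ℝ) (hm : m < 0) (hθ : 0 < θ) (hC₀ : 0 < C₀)
    (v₀ : Euc n → ℝ) (hcont : Continuous v₀) (hpos : ∀ x, 0 < v₀ x)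
    (hupp : ∀ x : Euc n, v₀ x ≤ C₀ * (1 + ‖x‖) ^ θ)
    (v : Euc n → ℝ → ℝ) (hv : IsSolF n m v₀ v ⊤) (hvpos : PosOn n v ⊤) :
    ∃ C : ℝ, 0 < C ∧ ∀ t : ℝ, 1 < t →
      (⨅ x : Euc n, v x t) ≤ C * t ^ (θ / ((1 - m) * θ + 2)) := by
  have hd : 0 < (1 - m) * θ + 2 := by nlinarith
  have hexp : 0 < 1 - 1 / m := by
    have : 1 / m < 0 := one_div_neg.2 hm
    linarith
  obtain ⟨δ, hδ, hδ1, hδ2⟩ : ∃ δ : ℝ, 0 < δ ∧ δ < (C₀ * 2 ^ θ) ^ m ∧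
      4 * n * δ ^ (1 - 1 / m) < 1 := by
    have hlim : Tendsto (fun δ : ℝ => 4 * n * δ ^ (1 - 1 / m)) (𝓝[>] 0) (𝓝 0) := by
      have h := ((Real.continuousAt_rpow_const 0 (1 - 1 / m) (Or.inr hexp.le)).tendsto.const_mul
        (4 * (n : ℝ))).mono_left (nhdsWithin_le_nhds (s := Ioi 0))
      rwa [Real.zero_rpow hexp.ne', mul_zero] at h
    have h1 : ∀ᶠ δ : ℝ in 𝓝[>] 0, δ < (C₀ * 2 ^ θ) ^ m :=
      nhdsWithin_le_nhds (gt_mem_nhds (by positivity))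
    obtain ⟨δ, h⟩ := (Eventually.and (eventually_mem_nhdsWithin (a := (0 : ℝ)) (s := Ioi 0))
      (h1.and (hlim.eventually_lt_const one_pos))).exists
    exact ⟨δ, h⟩
  refine ⟨(δ / 2) ^ (1 / m), by positivity, fun t ht => ?_⟩
  have ht0 : 0 < t := by linarith
  set R := t ^ (1 / ((1 - m) * θ + 2)) with hRdef
  have hR1 : 1 ≤ R := Real.one_le_rpow ht.le (by positivity)
  have hR : 0 < R := by linarith
  have htR : t = R ^ ((1 - m) * θ + 2) := by
    rw [hRdef, ← Real.rpow_mul ht0.le, one_div_mul_cancel hd.ne', Real.rpow_one]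
  have hinit : ∀ x, ‖x‖ ≤ R → δ * R ^ (m * θ) < v₀ x ^ m := by
    intro x hx
    have h1 : v₀ x ≤ C₀ * 2 ^ θ * R ^ θ := by
      calc v₀ x ≤ C₀ * (1 + ‖x‖) ^ θ := hupp x
        _ ≤ C₀ * (2 * R) ^ θ := by
          gcongr
          linarith
        _ = C₀ * 2 ^ θ * R ^ θ := by rw [Real.mul_rpow (by norm_num) hR.le, mul_assoc]
    calc δ * R ^ (m * θ) < (C₀ * 2 ^ θ) ^ m * R ^ (m * θ) := by gcongr
      _ = (C₀ * 2 ^ θ * R ^ θ) ^ m := by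
        rw [Real.mul_rpow (x := C₀ * 2 ^ θ) (by positivity) (by positivity), ← Real.rpow_mul hR.le,
          mul_comm θ]
      _ ≤ v₀ x ^ m := Real.rpow_le_rpow_of_nonpos (hpos x) h1 hm.le
  have hsmall : 4 * n * t * (δ * R ^ (m * θ)) ^ (1 - 1 / m) < R ^ 2 := by
    have h1 : t * (R ^ (m * θ)) ^ (1 - 1 / m) = R ^ 2 := by
      rw [← Real.rpow_mul hR.le, htR, ← Real.rpow_add hR, ← Real.rpow_natCast]
      congr 1
      have := hm.ne
      field_simp
      push_cast
      ring
    rw [Real.mul_rpow hδ.le (by positivity)]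
    calc 4 * n * t * (δ ^ (1 - 1 / m) * (R ^ (m * θ)) ^ (1 - 1 / m))
        = 4 * n * δ ^ (1 - 1 / m) * R ^ 2 := by rw [← h1]; ring
      _ < 1 * R ^ 2 := by gcongr
      _ = R ^ 2 := one_mul _
  have hb := barrier_le_rpow hm hv hvpos (A := δ * R ^ (m * θ)) (by positivity) hR ht0 hinit hsmall
  have hvt : 0 < v 0 t := hvpos 0 t ht0.le ENNReal.ofReal_lt_top
  have hbdd : BddBelow (range fun x => v x t) := by
    refine ⟨0, ?_⟩
    rintro _ ⟨x, rfl⟩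
    exact (hvpos x t ht0.le ENNReal.ofReal_lt_top).le
  calc (⨅ x, v x t) ≤ v 0 t := ciInf_le hbdd 0
    _ = (v 0 t ^ m) ^ (1 / m) := by
      rw [← Real.rpow_mul hvt.le, mul_one_div_cancel hm.ne, Real.rpow_one]
    _ ≤ (δ * R ^ (m * θ) / 2) ^ (1 / m) :=
      Real.rpow_le_rpow_of_nonpos (by positivity) hb (one_div_neg.2 hm).le
    _ = (δ / 2) ^ (1 / m) * R ^ θ := by
      rw [mul_div_right_comm, Real.mul_rpow (by positivity) (by positivity), ← Real.rpow_mul hR.le]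
      congr 2
      have := hm.ne
      field_simp
    _ = (δ / 2) ^ (1 / m) * t ^ (θ / ((1 - m) * θ + 2)) := by
      rw [hRdef, ← Real.rpow_mul ht0.le, one_div_mul_eq_div]
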